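/- arXiv:2007.01212 — 11 statements merged into one kernel-verified Lean document; each statement's English description precedes it below -/
import Mathlib

section
/- Let G ⊆ ℝ^m be a convex set, let J and K be finite index sets, let m_i > 0 and Δt > 0 be real numbers, let d_j ≥ 0 for j ∈ J and d_k ≥ 0 for k ∈ K be real coefficients, and let u ∈ G and ū_j ∈ G (j ∈ J), ū_k ∈ G (k ∈ K) be states. If the CFL-type condition (2Δt/m_i)·(∑_{j∈J} d_j + ∑_{k∈K} d_k) ≤ 1 holds, then the forward-Euler update ũ = u − (2Δt/m_i)·(∑_{j∈J} d_j + ∑_{k∈K} d_k)·u + (2Δt/m_i)·(∑_{j∈J} d_j ū_j + ∑_{k∈K} d_k ū_k) is a convex combination of u and the states ū_j, ū_k, and therefore ũ ∈ G. -/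
/-- A subconvex combination of points of a convex set, completed by the missing weight on a further
point of the set, stays in the set. -/
theorem Convex.sub_smul_add_sum_mem {E ι : Type*} [AddCommGroup E] [Module ℝ E] [Fintype ι]
    {s : Set E} (hs : Convex ℝ s) {w : ι → ℝ} {z : ι → E} {x : E} (hw : ∀ i, 0 ≤ w i)
    (hsum : ∑ i, w i ≤ 1) (hx : x ∈ s) (hz : ∀ i, z i ∈ s) :
    x - (∑ i, w i) • x + ∑ i, w i • z i ∈ s := by
  have h := hs.sum_mem (t := Finset.univ) (w := fun o : Option ι => o.elim (1 - ∑ i, w i) w)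
    (z := fun o => o.elim x z)
    (by rintro (_ | i) -
        · exact sub_nonneg.2 hsum
        · exact hw i)
    (by simp [Fintype.sum_option])
    (by rintro (_ | i) -
        · exact hx
        · exact hz i)
  simpa [Fintype.sum_option, sub_smul] using h

/-- One forward Euler step of the bar-state form of the low order scheme is a
convex combination of the old state and the bar states, hence stays in the
convex invariant set `G`. -/
theorem forward_euler_update_mem_invariant_set
    {m : ℕ} {G : Set (Fin m → ℝ)} (hG : Convex ℝ G)
    {J K : Type*} [Fintype J] [Fintype K]
    (mi Δt : ℝ) (hmi : 0 < mi) (hΔt : 0 < Δt)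
    (dJ : J → ℝ) (dK : K → ℝ)
    (hdJ : ∀ j, 0 ≤ dJ j) (hdK : ∀ k, 0 ≤ dK k)
    (u : Fin m → ℝ) (ubarJ : J → Fin m → ℝ) (ubarK : K → Fin m → ℝ)
    (hu : u ∈ G) (hubarJ : ∀ j, ubarJ j ∈ G) (hubarK : ∀ k, ubarK k ∈ G)
    (hcfl : (2 * Δt / mi) * (∑ j, dJ j + ∑ k, dK k) ≤ 1) :
    u - ((2 * Δt / mi) * (∑ j, dJ j + ∑ k, dK k)) • u
      + (2 * Δt / mi) • (∑ j, dJ j • ubarJ j + ∑ k, dK k • ubarK k) ∈ G := by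
  have hc : 0 ≤ 2 * Δt / mi := by positivity
  have h := hG.sub_smul_add_sum_mem
    (w := Sum.elim (fun j => 2 * Δt / mi * dJ j) (fun k => 2 * Δt / mi * dK k))
    (z := Sum.elim ubarJ ubarK) (x := u)
    (by rintro (j | k)
        · exact mul_nonneg hc (hdJ j)
        · exact mul_nonneg hc (hdK k))
    (by simpa [Fintype.sum_sum_type, ← Finset.mul_sum, ← mul_add] using hcfl)
    hu
    (by rintro (j | k)
        · exact hubarJ j
        · exact hubarK k)
  simpa only [Fintype.sum_sum_type, Sum.elim_inl, Sum.elim_inr, mul_smul, ← Finset.mul_sum,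
    ← Finset.smul_sum, ← mul_add, ← smul_add] using h
end

section
/- Let F : ℝ → ℝ^d be differentiable, let c ∈ ℝ^d, let u, v ∈ ℝ, and let d₀ > 0 be such that |F'(w)·c| ≤ d₀ for every w in the closed interval [min{u,v}, max{u,v}]. Then the bar state ū = (u+v)/2 − ((F(v) − F(u))·c)/(2d₀) satisfies min{u,v} ≤ ū ≤ max{u,v}. -/
theorem hasDerivAt_sum_mul {d : ℕ} {F : ℝ → (Fin d → ℝ)} {w : ℝ}
    (hF : DifferentiableAt ℝ F w) (c : Fin d → ℝ) :
    HasDerivAt (fun t => ∑ i, F t i * c i) (∑ i, deriv F w i * c i) w :=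
  HasDerivAt.fun_sum fun i _ => (hasDerivAt_pi.1 hF.hasDerivAt i).mul_const (c i)

/-- Scalar bar states are bounded by the minimum and maximum of the two
contributing states (mean value theorem argument). -/
theorem bar_state_bounds
    {d : ℕ} (F : ℝ → (Fin d → ℝ)) (hF : Differentiable ℝ F)
    (c : Fin d → ℝ) (u v : ℝ) (d₀ : ℝ) (hd₀ : 0 < d₀)
    (hspeed : ∀ w ∈ Set.Icc (min u v) (max u v),
      |∑ i, deriv F w i * c i| ≤ d₀) :
    min u v ≤ (u + v) / 2 - (∑ i, (F v i - F u i) * c i) / (2 * d₀) ∧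
      (u + v) / 2 - (∑ i, (F v i - F u i) * c i) / (2 * d₀) ≤ max u v := by
  have hmvt : |∑ i, (F v i - F u i) * c i| ≤ d₀ * |v - u| := by
    have h := (convex_Icc (min u v) (max u v)).norm_image_sub_le_of_norm_hasDerivWithin_le
      (fun w _ => (hasDerivAt_sum_mul (hF w) c).hasDerivWithinAt) hspeed
      (x := u) (y := v) ⟨min_le_left _ _, le_max_left _ _⟩ ⟨min_le_right _ _, le_max_right _ _⟩
    simpa only [Real.norm_eq_abs, sub_mul, Finset.sum_sub_distrib] using h
  have hquot : |(∑ i, (F v i - F u i) * c i) / (2 * d₀)| ≤ |v - u| / 2 := by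
    rw [abs_div, abs_of_pos (by positivity : 0 < 2 * d₀), div_le_iff₀ (by positivity)]
    linarith
  obtain ⟨hlower, hupper⟩ := abs_le.1 hquot
  rcases le_total u v with h | h
  · rw [abs_of_nonneg (sub_nonneg.2 h)] at hlower hupper
    rw [min_eq_left h, max_eq_right h]
    constructor <;> linarith
  · rw [abs_of_nonpos (sub_nonpos.2 h)] at hlower hupper
    rw [min_eq_right h, max_eq_left h]
    constructor <;> linarith
end

section
/- Let d > 0 and let ū_ij, ū_ji, u_i^min, u_i^max, u_j^min, u_j^max ∈ ℝ satisfy u_i^min ≤ ū_ij ≤ u_i^max and u_j^min ≤ ū_ji ≤ u_j^max. For f ∈ ℝ define the limited flux f* = min{f, 2d·min{u_i^max − ū_ij, ū_ji − u_j^min}} if f ≥ 0, and f* = max{f, 2d·max{u_i^min − ū_ij, ū_ji − u_j^max}} if f < 0. Then the flux-corrected bar states satisfy u_i^min ≤ ū_ij + f*/(2d) ≤ u_i^max and u_j^min ≤ ū_ji − f*/(2d) ≤ u_j^max. -/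
/-- The monolithic convex limiting formula for volumetric fluxes keeps both
flux-corrected bar states within the prescribed local bounds. -/
theorem limited_bar_states_in_bounds
    (d ubarij ubarji uimin uimax ujmin ujmax f : ℝ)
    (hd : 0 < d)
    (hi1 : uimin ≤ ubarij) (hi2 : ubarij ≤ uimax)
    (hj1 : ujmin ≤ ubarji) (hj2 : ubarji ≤ ujmax)
    (fstar : ℝ)
    (hfstar : fstar =
      if 0 ≤ f then
        min f (2 * d * min (uimax - ubarij) (ubarji - ujmin))
      else
        max f (2 * d * max (uimin - ubarij) (ubarji - ujmax))) :
    (uimin ≤ ubarij + fstar / (2 * d) ∧ ubarij + fstar / (2 * d) ≤ uimax) ∧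
    (ujmin ≤ ubarji - fstar / (2 * d) ∧ ubarji - fstar / (2 * d) ≤ ujmax) := by
  have h2d : 0 < 2 * d := by positivity
  split_ifs at hfstar with hf
  · have hmin : 0 ≤ min (uimax - ubarij) (ubarji - ujmin) :=
      le_min (sub_nonneg.2 hi2) (sub_nonneg.2 hj1)
    have hnonneg : 0 ≤ fstar / (2 * d) :=
      div_nonneg (hfstar ▸ le_min hf (mul_nonneg h2d.le hmin)) h2d.le
    have hle : fstar / (2 * d) ≤ min (uimax - ubarij) (ubarji - ujmin) :=
      (div_le_iff₀' h2d).2 (hfstar ▸ min_le_right _ _)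
    obtain ⟨hlei, hlej⟩ := le_min_iff.1 hle
    refine ⟨⟨?_, ?_⟩, ?_, ?_⟩ <;> linarith
  · have hmax : max (uimin - ubarij) (ubarji - ujmax) ≤ 0 :=
      max_le (sub_nonpos.2 hi1) (sub_nonpos.2 hj2)
    have hnonpos : fstar / (2 * d) ≤ 0 :=
      div_nonpos_of_nonpos_of_nonneg
        (hfstar ▸ max_le (not_le.1 hf).le (mul_nonpos_of_nonneg_of_nonpos h2d.le hmax)) h2d.le
    have hge : max (uimin - ubarij) (ubarji - ujmax) ≤ fstar / (2 * d) :=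
      (le_div_iff₀' h2d).2 (hfstar ▸ le_max_right _ _)
    obtain ⟨hgei, hgej⟩ := max_le_iff.1 hge
    refine ⟨⟨?_, ?_⟩, ?_, ?_⟩ <;> linarith
end

section
/- Let d > 0 and let ū_ij, ū_ji, u_i^min, u_i^max, u_j^min, u_j^max ∈ ℝ satisfy u_i^min ≤ ū_ij ≤ u_i^max and u_j^min ≤ ū_ji ≤ u_j^max. For f ∈ ℝ let L(f; ū_ij, ū_ji, u_i^min, u_i^max, u_j^min, u_j^max) denote the limited flux defined as min{f, 2d·min{u_i^max − ū_ij, ū_ji − u_j^min}} if f ≥ 0 and max{f, 2d·max{u_i^min − ū_ij, ū_ji − u_j^max}} if f < 0. Then for every f ∈ ℝ one has L(−f; ū_ji, ū_ij, u_j^min, u_j^max, u_i^min, u_i^max) = −L(f; ū_ij, ū_ji, u_i^min, u_i^max, u_j^min, u_j^max); that is, if the raw fluxes of the node pair satisfy f_ji = −f_ij, then the limited fluxes satisfy f_ji* = −f_ij*, so conservation is retained. -/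
/-- The monolithic convex limiting operator for volumetric fluxes: raw flux `f`,
bar states of the node pair, and local bounds. -/
noncomputable def mclLimiter (d f ubarij ubarji uimin uimax ujmin ujmax : ℝ) : ℝ :=
  if 0 ≤ f then
    min f (2 * d * min (uimax - ubarij) (ubarji - ujmin))
  else
    max f (2 * d * max (uimin - ubarij) (ubarji - ujmax))

/-- Skew-symmetry of the limited volumetric fluxes: if the raw fluxes of a node
pair satisfy `f_ji = -f_ij`, then the limited fluxes satisfy `f_ji* = -f_ij*`,
so conservation is retained. -/
theorem limited_flux_skew_symmetric
    (d ubarij ubarji uimin uimax ujmin ujmax : ℝ)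
    (hd : 0 < d)
    (hi1 : uimin ≤ ubarij) (hi2 : ubarij ≤ uimax)
    (hj1 : ujmin ≤ ubarji) (hj2 : ubarji ≤ ujmax) :
    ∀ f : ℝ,
      mclLimiter d (-f) ubarji ubarij ujmin ujmax uimin uimax =
        -mclLimiter d f ubarij ubarji uimin uimax ujmin ujmax := by
  intro f
  have neg_max (a b c e : ℝ) :
      2 * d * max (a - b) (c - e) = -(2 * d * min (e - c) (b - a)) := by
    rw [← mul_neg, ← max_neg_neg, neg_sub, neg_sub, max_comm]
  unfold mclLimiter
  rcases lt_trichotomy f 0 with hf | rfl | hf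
  · rw [if_pos (by linarith), if_neg (by linarith), neg_max, ← min_neg_neg, neg_neg]
  · have bound_nonneg {a b : ℝ} (ha : 0 ≤ a) (hb : 0 ≤ b) : 0 ≤ 2 * d * min a b :=
      mul_nonneg (by positivity) (le_min ha hb)
    simp only [neg_zero, le_refl, if_true]
    rw [min_eq_left (bound_nonneg (sub_nonneg.2 hj2) (sub_nonneg.2 hi1)),
      min_eq_left (bound_nonneg (sub_nonneg.2 hi2) (sub_nonneg.2 hj1)), neg_zero]
  · rw [if_neg (by linarith), if_pos hf.le, neg_max, max_neg_neg]
end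

section
/- Let d > 0 and let ū, u^min, u^max ∈ ℝ satisfy u^min ≤ ū ≤ u^max. For f ∈ ℝ define the limited interfacial flux f* = min{f, 2d·min{u^max − ū, ū − u^min}} if f ≥ 0, and f* = max{f, 2d·max{u^min − ū, ū − u^max}} if f < 0. Then: (i) u^min ≤ ū + f*/(2d) ≤ u^max and u^min ≤ ū − f*/(2d) ≤ u^max; (ii) there exists α ∈ [0,1] with f* = α·f; (iii) the limited flux obtained from the raw flux −f equals −f*, so the conservation property of the antidiffusive DG fluxes is preserved. -/
/-- Clipping `f` to `[-B, B]`, written as a case split on the sign of `f`. -/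
theorem ite_min_max_eq_clip {B : ℝ} (hB : 0 ≤ B) (f : ℝ) :
    (if 0 ≤ f then min f B else max f (-B)) = max (-B) (min f B) := by
  split_ifs with hf
  · exact (max_eq_right ((neg_nonpos.mpr hB).trans (le_min hf hB))).symm
  · rw [min_eq_left ((not_le.mp hf).le.trans hB), max_comm]

theorem clip_neg {B : ℝ} (hB : 0 ≤ B) (f : ℝ) :
    max (-B) (min (-f) B) = -max (-B) (min f B) := by
  rw [← min_neg_neg, ← max_neg_neg, neg_neg, max_min_distrib_left,
    max_eq_right (neg_le_self hB), max_comm, min_comm, max_comm]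

theorem exists_clip_eq_mul {B : ℝ} (hB : 0 ≤ B) (f : ℝ) :
    ∃ α ∈ Set.Icc (0 : ℝ) 1, max (-B) (min f B) = α * f := by
  rcases le_or_gt |f| B with h | h
  · obtain ⟨hl, hr⟩ := abs_le.mp h
    exact ⟨1, by simp, by rw [min_eq_left hr, max_eq_right hl, one_mul]⟩
  · have hpos : 0 < |f| := hB.trans_lt h
    refine ⟨B / |f|, ⟨by positivity, (div_le_one hpos).mpr h.le⟩, ?_⟩
    rcases lt_abs.mp h with hf | hf
    · have hf0 : 0 < f := hB.trans_lt hf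
      rw [abs_of_pos hf0, div_mul_cancel₀ _ hf0.ne', min_eq_right hf.le,
        max_eq_right (neg_le_self hB)]
    · have hf0 : f < 0 := by linarith
      rw [abs_of_neg hf0, div_neg, neg_mul, div_mul_cancel₀ _ hf0.ne,
        min_eq_left (by linarith), max_eq_left (by linarith)]

/-- The interfacial flux limiter: (i) both flux-corrected bar states stay in
the local bounds, (ii) the limited flux is the raw flux times a correction
factor in `[0,1]`, and (iii) limiting the raw flux `-f` gives `-f*`, so
conservation of the antidiffusive DG fluxes is preserved. -/
theorem interfacial_limiter_properties
    (d ubar umin umax f : ℝ)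
    (hd : 0 < d) (h1 : umin ≤ ubar) (h2 : ubar ≤ umax)
    (fstar : ℝ)
    (hfstar : fstar =
      if 0 ≤ f then
        min f (2 * d * min (umax - ubar) (ubar - umin))
      else
        max f (2 * d * max (umin - ubar) (ubar - umax))) :
    ((umin ≤ ubar + fstar / (2 * d) ∧ ubar + fstar / (2 * d) ≤ umax) ∧
     (umin ≤ ubar - fstar / (2 * d) ∧ ubar - fstar / (2 * d) ≤ umax)) ∧
    (∃ α ∈ Set.Icc (0 : ℝ) 1, fstar = α * f) ∧
    ((if 0 ≤ -f then
        min (-f) (2 * d * min (umax - ubar) (ubar - umin))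
      else
        max (-f) (2 * d * max (umin - ubar) (ubar - umax))) = -fstar) := by
  have hm : 0 ≤ min (umax - ubar) (ubar - umin) :=
    le_min (sub_nonneg.mpr h2) (sub_nonneg.mpr h1)
  have hmax : max (umin - ubar) (ubar - umax) = -min (umax - ubar) (ubar - umin) := by
    rw [← max_neg_neg, neg_sub, neg_sub, max_comm]
  have hma := min_le_left (umax - ubar) (ubar - umin)
  have hmb := min_le_right (umax - ubar) (ubar - umin)
  rw [hmax] at hfstar ⊢
  generalize min (umax - ubar) (ubar - umin) = m at *
  have hd2 : 0 < 2 * d := by positivity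
  have hB : 0 ≤ 2 * d * m := by positivity
  rw [mul_neg, ite_min_max_eq_clip hB] at hfstar ⊢
  have hlow : -m ≤ fstar / (2 * d) := by
    rw [le_div_iff₀ hd2, hfstar]
    exact le_trans (by linarith) (le_max_left _ _)
  have hupp : fstar / (2 * d) ≤ m := by
    rw [div_le_iff₀ hd2, hfstar]
    exact max_le (by linarith) ((min_le_right _ _).trans (by linarith))
  refine ⟨⟨⟨?_, ?_⟩, ?_, ?_⟩, ?_, ?_⟩
  · linarith
  · linarith
  · linarith
  · linarith
  · rw [hfstar]
    exact exists_clip_eq_mul hB f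
  · rw [hfstar]
    exact clip_neg hB f
end

section
/- Let d > 0, let ρ̄_ij*, ρ̄_ji* ≥ 0, let φ̄ ∈ ℝ, and let bounds satisfy φ_i^min ≤ φ̄ ≤ φ_i^max and φ_j^min ≤ φ̄ ≤ φ_j^max. Define g_ij^min = 2d·ρ̄_ij*·(φ_i^min − φ̄), g_ij^max = 2d·ρ̄_ij*·(φ_i^max − φ̄), g_ji^min = 2d·ρ̄_ji*·(φ_j^min − φ̄), g_ji^max = 2d·ρ̄_ji*·(φ_j^max − φ̄). For g ∈ ℝ define g* = min{g, min{g_ij^max, −g_ji^min}} if g ≥ 0 and g* = max{g, max{g_ij^min, −g_ji^max}} if g < 0. Then g_ij^min ≤ g* ≤ g_ij^max and g_ji^min ≤ −g* ≤ g_ji^max; consequently, the limited products satisfy ρ̄_ij*·φ_i^min ≤ ρ̄_ij*·φ̄ + g*/(2d) ≤ ρ̄_ij*·φ_i^max and ρ̄_ji*·φ_j^min ≤ ρ̄_ji*·φ̄ − g*/(2d) ≤ ρ̄_ji*·φ_j^max. -/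
/-- Sequential limiting of a conserved product for a volumetric node pair:
the limited remainder flux `g*` satisfies the two-sided bound constraints of
both nodes, so the flux-corrected bar states of the product stay in the ranges
`[ρ̄*·φ^min, ρ̄*·φ^max]`. -/
theorem sequential_limiter_volumetric
    (d ρij ρji φbar φimin φimax φjmin φjmax g : ℝ)
    (hd : 0 < d) (hρij : 0 ≤ ρij) (hρji : 0 ≤ ρji)
    (hi1 : φimin ≤ φbar) (hi2 : φbar ≤ φimax)
    (hj1 : φjmin ≤ φbar) (hj2 : φbar ≤ φjmax)
    (gijmin gijmax gjimin gjimax gstar : ℝ)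
    (hgijmin : gijmin = 2 * d * ρij * (φimin - φbar))
    (hgijmax : gijmax = 2 * d * ρij * (φimax - φbar))
    (hgjimin : gjimin = 2 * d * ρji * (φjmin - φbar))
    (hgjimax : gjimax = 2 * d * ρji * (φjmax - φbar))
    (hgstar : gstar =
      if 0 ≤ g then min g (min gijmax (-gjimin))
      else max g (max gijmin (-gjimax))) :
    (gijmin ≤ gstar ∧ gstar ≤ gijmax) ∧
    (gjimin ≤ -gstar ∧ -gstar ≤ gjimax) ∧
    (ρij * φimin ≤ ρij * φbar + gstar / (2 * d) ∧
      ρij * φbar + gstar / (2 * d) ≤ ρij * φimax) ∧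
    (ρji * φjmin ≤ ρji * φbar - gstar / (2 * d) ∧
      ρji * φbar - gstar / (2 * d) ≤ ρji * φjmax) := by
  have h2d : 0 < 2 * d := by positivity
  have hcij : 0 ≤ 2 * d * ρij := by positivity
  have hcji : 0 ≤ 2 * d * ρji := by positivity
  have hijmin : gijmin ≤ 0 := by
    rw [hgijmin]; exact mul_nonpos_of_nonneg_of_nonpos hcij (sub_nonpos.2 hi1)
  have hijmax : 0 ≤ gijmax := by
    rw [hgijmax]; exact mul_nonneg hcij (sub_nonneg.2 hi2)
  have hjimin : gjimin ≤ 0 := by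
    rw [hgjimin]; exact mul_nonpos_of_nonneg_of_nonpos hcji (sub_nonpos.2 hj1)
  have hjimax : 0 ≤ gjimax := by
    rw [hgjimax]; exact mul_nonneg hcji (sub_nonneg.2 hj2)
  have hbounds : (gijmin ≤ gstar ∧ gstar ≤ gijmax) ∧ (gjimin ≤ -gstar ∧ -gstar ≤ gjimax) := by
    grind
  obtain ⟨⟨h1, h2⟩, h3, h4⟩ := hbounds
  refine ⟨⟨h1, h2⟩, ⟨h3, h4⟩, ?_⟩
  obtain ⟨t, ht⟩ : ∃ t, gstar = 2 * d * t := ⟨gstar / (2 * d), by field_simp⟩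
  have hdiv : gstar / (2 * d) = t := by rw [ht]; field_simp
  rw [hdiv]
  rw [hgijmin, ht, mul_assoc (2 * d)] at h1
  rw [hgijmax, ht, mul_assoc (2 * d)] at h2
  rw [hgjimin, ht, mul_assoc (2 * d) ρji, ← mul_neg] at h3
  rw [hgjimax, ht, mul_assoc (2 * d) ρji, ← mul_neg] at h4
  have k1 := le_of_mul_le_mul_left h1 h2d
  have k2 := le_of_mul_le_mul_left h2 h2d
  have k3 := le_of_mul_le_mul_left h3 h2d
  have k4 := le_of_mul_le_mul_left h4 h2d
  refine ⟨⟨?_, ?_⟩, ?_, ?_⟩ <;> linarith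
end

section
/- Let d > 0, let ρ̄* ≥ 0, let φ̄ ∈ ℝ and let bounds satisfy φ^min ≤ φ̄ ≤ φ^max. Define g^min = 2d·ρ̄*·(φ^min − φ̄) and g^max = 2d·ρ̄*·(φ^max − φ̄). For g ∈ ℝ define g* = min{g, min{g^max, −g^min}} if g ≥ 0 and g* = max{g, max{g^min, −g^max}} if g < 0. Then both ρ̄*·φ̄ + g*/(2d) and ρ̄*·φ̄ − g*/(2d) lie in the interval [ρ̄*·φ^min, ρ̄*·φ^max]. -/
/-- Sequential limiting of a conserved product across a DG interface: both
flux-corrected interfacial bar states of the product stay in the range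
`[ρ̄*·φ^min, ρ̄*·φ^max]`. -/
theorem sequential_limiter_interfacial
    (d ρbar φbar φmin φmax g : ℝ)
    (hd : 0 < d) (hρ : 0 ≤ ρbar)
    (h1 : φmin ≤ φbar) (h2 : φbar ≤ φmax)
    (gmin gmax gstar : ℝ)
    (hgmin : gmin = 2 * d * ρbar * (φmin - φbar))
    (hgmax : gmax = 2 * d * ρbar * (φmax - φbar))
    (hgstar : gstar =
      if 0 ≤ g then min g (min gmax (-gmin))
      else max g (max gmin (-gmax))) :
    ρbar * φbar + gstar / (2 * d) ∈ Set.Icc (ρbar * φmin) (ρbar * φmax) ∧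
    ρbar * φbar - gstar / (2 * d) ∈ Set.Icc (ρbar * φmin) (ρbar * φmax) := by
  have hdρ : 0 ≤ 2 * d * ρbar := by positivity
  have hmin : gmin ≤ 0 := hgmin ▸ mul_nonpos_of_nonneg_of_nonpos hdρ (sub_nonpos.2 h1)
  have hmax : 0 ≤ gmax := hgmax ▸ mul_nonneg hdρ (sub_nonneg.2 h2)
  have hbounds : (gmin ≤ gstar ∧ gstar ≤ gmax) ∧ (-gmax ≤ gstar ∧ gstar ≤ -gmin) := by
    rw [hgstar]
    split_ifs <;> grind
  obtain ⟨⟨hl, hu⟩, hl', hu'⟩ := hbounds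
  have hd2 : 0 < 2 * d := by positivity
  have hlow : ρbar * (φmin - φbar) = gmin / (2 * d) := by
    rw [hgmin]; field_simp
  have hupp : ρbar * (φmax - φbar) = gmax / (2 * d) := by
    rw [hgmax]; field_simp
  have e1 := div_le_div_of_nonneg_right hl hd2.le
  have e2 := div_le_div_of_nonneg_right hu hd2.le
  have e3 := div_le_div_of_nonneg_right hl' hd2.le
  have e4 := div_le_div_of_nonneg_right hu' hd2.le
  rw [neg_div] at e3 e4
  simp only [Set.mem_Icc]
  refine ⟨⟨?_, ?_⟩, ?_, ?_⟩ <;> linarith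
end

section
/- Let N, d, m ∈ ℕ, and for i, j ∈ {1,…,N} let c_ij, c̃_ij, B_ij ∈ ℝ^d, b_i ∈ ℝ^d and F_i ∈ ℝ^{m×d} satisfy: (i) ∑_{j=1}^N c̃_ij = 0 for all i; (ii) ∑_{j=1}^N c_ij = 0 for all i; (iii) ∑_{i=1}^N (c̃_ij − c_ij) = 0 for all j; (iv) c_ij + c_ji = B_ij with B_ij = B_ji for all i, j; (v) b_i = ∑_{j=1}^N B_ij for all i. Then ∑_{i=1}^N [ ∑_{j=1}^N (F_j − F_i)·c̃_ij − F_i·b_i ] = 0 in ℝ^m (where F·c denotes the matrix–vector product). -/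
open Finset Matrix

/-- Algebraic core of the lemma that the raw antidiffusive element
contributions sum to zero over each element. -/
theorem antidiffusive_contributions_sum_to_zero
    (N d m : ℕ)
    (c ctil B : Fin N → Fin N → Fin d → ℝ)
    (b : Fin N → Fin d → ℝ)
    (F : Fin N → Matrix (Fin m) (Fin d) ℝ)
    (h1 : ∀ i, ∑ j, ctil i j = 0)
    (h2 : ∀ i, ∑ j, c i j = 0)
    (h3 : ∀ j, ∑ i, (ctil i j - c i j) = 0)
    (h4 : ∀ i j, c i j + c j i = B i j)
    (hBsymm : ∀ i j, B i j = B j i)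
    (h5 : ∀ i, b i = ∑ j, B i j) :
    ∑ i, (∑ j, (F j - F i).mulVec (ctil i j) - (F i).mulVec (b i)) =
      (0 : Fin m → ℝ) := by
  have colsum (j) : ∑ i, ctil i j = b j := by
    have h := h3 j
    rw [sum_sub_distrib, sub_eq_zero] at h
    rw [h, h5]
    simp only [← h4, sum_add_distrib, h2, zero_add]
  have inner (i) : ∑ j, (F j - F i).mulVec (ctil i j) = ∑ j, (F j).mulVec (ctil i j) := by
    simp only [sub_mulVec, sum_sub_distrib, ← mulVec_sum, h1, mulVec_zero, sub_zero]
  simp only [inner, sum_sub_distrib]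
  rw [sum_comm]
  simp only [← mulVec_sum, colsum, sub_self]
end

section
/- Let M ∈ ℝ^{N×N} be a symmetric invertible matrix, let m_i = ∑_{j=1}^N M_ij be its row sums, and let M_L = diag(m_1,…,m_N). Then for every matrix C ∈ ℝ^{N×N}, the preconditioned matrix C̃ = M_L·M⁻¹·C satisfies: (i) the column sums of C̃ equal the column sums of C, i.e. ∑_i C̃_ij = ∑_i C_ij for all j (equivalently, C̃ − C has zero column sums); and (ii) if C has zero row sums (C·𝟙 = 0), then C̃ has zero row sums. -/
open Matrix

/-- Properties of the lumped-mass preconditioner `P = M_L · M⁻¹`: applying it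
to any matrix `C` preserves the column sums, and preserves the zero row sum
property. -/
theorem preconditioned_matrix_sums
    (N : ℕ) (M : Matrix (Fin N) (Fin N) ℝ)
    (hMsymm : M.IsSymm) (hMinv : IsUnit M.det)
    (mrow : Fin N → ℝ) (hmrow : ∀ i, mrow i = ∑ j, M i j)
    (C : Matrix (Fin N) (Fin N) ℝ) :
    (∀ j, ∑ i, (Matrix.diagonal mrow * M⁻¹ * C) i j = ∑ i, C i j) ∧
    ((∀ i, ∑ j, C i j = 0) →
      ∀ i, ∑ j, (Matrix.diagonal mrow * M⁻¹ * C) i j = 0) := by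
  constructor
  · have hrow : (1 : Fin N → ℝ) ᵥ* diagonal mrow = 1 ᵥ* M := by
      ext i
      rw [vecMul_diagonal, Pi.one_apply, one_mul, hmrow, vecMul, one_dotProduct]
      exact Finset.sum_congr rfl fun j _ => hMsymm.apply j i
    have hcol : (1 : Fin N → ℝ) ᵥ* (diagonal mrow * M⁻¹ * C) = 1 ᵥ* C := by
      rw [Matrix.mul_assoc, ← vecMul_vecMul, hrow, vecMul_vecMul,
        mul_nonsing_inv_cancel_left M C hMinv]
    intro j
    simpa [vecMul, one_dotProduct] using congrFun hcol j
  · intro hC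
    have hC1 : C *ᵥ 1 = 0 := by
      ext i
      simpa [mulVec, dotProduct_one] using hC i
    have hP : (diagonal mrow * M⁻¹ * C) *ᵥ 1 = 0 := by
      rw [← mulVec_mulVec, hC1, mulVec_zero]
    intro i
    simpa only [mulVec, dotProduct_one, Pi.zero_apply] using congrFun hP i
end

section
/- Let N, m ∈ ℕ, let M̃ ∈ ℝ^{N×N} be symmetric with row sums m̃_i = ∑_j M̃_ij and M̃_L = diag(m̃_1,…,m̃_N), let D ∈ ℝ^{N×N} be symmetric, let u_1,…,u_N, v_1,…,v_N, f_1,…,f_N ∈ ℝ^m, set q_i = f_i + ∑_{j=1}^N D_ij·(u_j − u_i), and assume (M̃_L − M̃)·v = q componentwise, i.e. ∑_j (m̃_i δ_ij − M̃_ij)·v_j = q_i for all i. Define, for j ≠ i, f_ij = M̃_ij·(v_i − v_j) + D_ij·(u_i − u_j). Then ∑_{j≠i} f_ij = f_i for every i, and f_ij = −f_ji for all i ≠ j. -/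
open Finset

/-- The flux decomposition used in the limiter: the pairwise fluxes
`f_ij = M̃_ij (v_i − v_j) + D_ij (u_i − u_j)` sum to the antidiffusive element
contribution `f_i` of each node and are skew-symmetric. -/
theorem flux_decomposition
    (N m : ℕ)
    (Mt : Matrix (Fin N) (Fin N) ℝ) (hMt : Mt.IsSymm)
    (mt : Fin N → ℝ) (hmt : ∀ i, mt i = ∑ j, Mt i j)
    (D : Matrix (Fin N) (Fin N) ℝ) (hD : D.IsSymm)
    (u v f q : Fin N → Fin m → ℝ)
    (hq : ∀ i, q i = f i + ∑ j, D i j • (u j - u i))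
    (hv : ∀ i, ∑ j, (mt i * (if i = j then 1 else 0) - Mt i j) • v j = q i)
    (fij : Fin N → Fin N → Fin m → ℝ)
    (hfij : ∀ i j, i ≠ j → fij i j = Mt i j • (v i - v j) + D i j • (u i - u j)) :
    (∀ i, ∑ j ∈ Finset.univ.erase i, fij i j = f i) ∧
    (∀ i j, i ≠ j → fij i j = -fij j i) := by
  refine ⟨fun i => ?_, fun i j hij => ?_⟩
  · have hsum : ∑ j ∈ Finset.univ.erase i, fij i j
        = ∑ j, (Mt i j • (v i - v j) + D i j • (u i - u j)) := by
      rw [← Finset.sum_erase (a := i) Finset.univ (by simp)]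
      exact Finset.sum_congr rfl fun j hj => hfij i j (Finset.ne_of_mem_erase hj).symm
    have hlaplace : ∑ j, Mt i j • (v i - v j) = q i := by
      rw [← hv i]
      simp [sub_smul, smul_sub, Finset.sum_sub_distrib, ← Finset.sum_smul, hmt]
    have hdiss : ∑ j, D i j • (u i - u j) = -∑ j, D i j • (u j - u i) := by
      rw [← Finset.sum_neg_distrib]
      exact Finset.sum_congr rfl fun j _ => by rw [← smul_neg, neg_sub]
    rw [hsum, Finset.sum_add_distrib, hlaplace, hdiss, hq, add_neg_cancel_right]
  · rw [hfij i j hij, hfij j i hij.symm, hMt.apply i j, hD.apply i j, neg_add, ← smul_neg,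
      ← smul_neg, neg_sub, neg_sub]
end

section
/- Let p ∈ ℕ and let b_m^p(x) = C(p,m)·x^m·(1−x)^{p−m} for 0 ≤ m ≤ p be the Bernstein polynomials of degree p. Define matrices M, Cmat, T ∈ ℝ^{(p+1)×(p+1)} (indices 0,…,p) by M_{ij} = ∫₀¹ b_i^p(x)·b_j^p(x) dx, Cmat_{ij} = ∫₀¹ b_i^p(x)·(b_j^p)'(x) dx, and T_{km} = p + 1 − m if k = m − 1, T_{km} = 2m − p if k = m, T_{km} = −(m + 1) if k = m + 1, and T_{km} = 0 otherwise. Then Cmat = M·T. -/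
open Polynomial intervalIntegral

namespace bernsteinPolynomial

/-- Degree elevation of Bernstein polynomials. -/
theorem succ_mul_eq_degree_elevation (R : Type*) [CommRing R] (n m : ℕ) :
    ((n : R[X]) + 1) * bernsteinPolynomial R n m =
      ((n : R[X]) + 1 - m) * bernsteinPolynomial R (n + 1) m +
        ((m : R[X]) + 1) * bernsteinPolynomial R (n + 1) (m + 1) := by
  rcases le_or_gt m n with h | h
  · obtain ⟨d, rfl⟩ := Nat.exists_eq_add_of_le h
    have h₁ := congrArg (Nat.cast (R := R[X])) (Nat.add_one_mul_choose_eq (m + d) m)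
    have h₂ := congrArg (Nat.cast (R := R[X])) (Nat.choose_mul_succ_eq (m + d) m)
    have e₁ : m + d + 1 - m = d + 1 := by omega
    have e₂ : m + d + 1 - (m + 1) = d := by omega
    have e₃ : m + d - m = d := by omega
    rw [e₁] at h₂
    push_cast at h₁ h₂
    simp only [bernsteinPolynomial, e₁, e₂, e₃]
    push_cast
    linear_combination X ^ m * (1 - X) ^ (d + 1) * h₂ + X ^ (m + 1) * (1 - X) ^ d * h₁
  · rw [eq_zero_of_lt R h, eq_zero_of_lt R (Nat.succ_lt_succ h)]
    rcases Nat.eq_or_lt_of_le (Nat.succ_le_of_lt h) with rfl | h'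
    · simp
    · simp [eq_zero_of_lt R h']

theorem derivative_zero_eq (R : Type*) [CommRing R] (n : ℕ) :
    derivative (bernsteinPolynomial R n 0) =
      -(n : R[X]) * bernsteinPolynomial R n 0 - bernsteinPolynomial R n 1 := by
  rw [derivative_zero]
  rcases n with _ | n
  · simp [eq_zero_of_lt R Nat.zero_lt_one]
  · have h := succ_mul_eq_degree_elevation R n 0
    push_cast at h ⊢
    linear_combination -h

theorem derivative_succ_eq (R : Type*) [CommRing R] (n m : ℕ) :
    derivative (bernsteinPolynomial R n (m + 1)) =
      ((n : R[X]) - m) * bernsteinPolynomial R n m +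
        (2 * ((m : R[X]) + 1) - n) * bernsteinPolynomial R n (m + 1) -
        ((m : R[X]) + 2) * bernsteinPolynomial R n (m + 2) := by
  rw [derivative_succ]
  rcases n with _ | n
  · rcases m with _ | m <;> simp [eq_zero_of_lt R]
  · have h₁ := succ_mul_eq_degree_elevation R n m
    have h₂ := succ_mul_eq_degree_elevation R n (m + 1)
    push_cast at h₁ h₂ ⊢
    linear_combination h₁ - h₂

/-- The derivative of a Bernstein polynomial in the Bernstein basis of the same degree. -/
theorem derivative_eval_eq_sum (p : ℕ) (m : Fin (p + 1)) (x : ℝ) :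
    (derivative (bernsteinPolynomial ℝ p m)).eval x =
      ∑ k : Fin (p + 1), (bernsteinPolynomial ℝ p k).eval x *
        (if (k : ℕ) + 1 = (m : ℕ) then (p : ℝ) + 1 - (m : ℕ)
          else if (k : ℕ) = (m : ℕ) then 2 * (m : ℕ) - (p : ℝ)
          else if (k : ℕ) = (m : ℕ) + 1 then -((m : ℕ) + 1)
          else 0) := by
  obtain ⟨m, hm⟩ := m
  rw [Fin.sum_univ_eq_sum_range (fun k => (bernsteinPolynomial ℝ p k).eval x *
        (if k + 1 = m then (p : ℝ) + 1 - m
          else if k = m then 2 * (m : ℝ) - p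
          else if k = m + 1 then -((m : ℝ) + 1)
          else 0))]
  have split : ∀ k : ℕ, (bernsteinPolynomial ℝ p k).eval x *
        (if k + 1 = m then (p : ℝ) + 1 - m
          else if k = m then 2 * (m : ℝ) - p
          else if k = m + 1 then -((m : ℝ) + 1)
          else 0) =
      (if k + 1 = m then (bernsteinPolynomial ℝ p k).eval x * ((p : ℝ) + 1 - m) else 0) +
      (if k = m then (bernsteinPolynomial ℝ p k).eval x * (2 * (m : ℝ) - p) else 0) +
      (if k = m + 1 then (bernsteinPolynomial ℝ p k).eval x * -((m : ℝ) + 1) else 0) := by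
    intro k
    split_ifs <;> first | omega | simp
  have top : (if m + 1 ∈ Finset.range (p + 1) then
      (bernsteinPolynomial ℝ p (m + 1)).eval x * -((m : ℝ) + 1) else 0) =
      (bernsteinPolynomial ℝ p (m + 1)).eval x * -((m : ℝ) + 1) := by
    split_ifs with h
    · rfl
    · rw [eq_zero_of_lt ℝ (by simpa using h)]
      simp
  simp only [split, Finset.sum_add_distrib]
  rw [Finset.sum_ite_eq', Finset.sum_ite_eq', top, if_pos (Finset.mem_range.2 hm)]
  rcases m with _ | m
  · rw [derivative_zero_eq]
    simp
    ring
  · simp only [Nat.add_right_cancel_iff]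
    rw [Finset.sum_ite_eq', if_pos (Finset.mem_range.2 (by omega)), derivative_succ_eq]
    simp
    ring

end bernsteinPolynomial

/-- The 1D Bernstein discrete gradient matrix equals the mass matrix times the
explicit tridiagonal matrix `T` with entries `p+1−m`, `2m−p`, `−(m+1)`
(formula of Lohmann et al.): `C = M·T`. -/
theorem bernstein_gradient_eq_mass_mul_tridiagonal
    (p : ℕ)
    (M Cmat T : Matrix (Fin (p + 1)) (Fin (p + 1)) ℝ)
    (hM : ∀ i j, M i j =
      ∫ x in (0 : ℝ)..1,
        (bernsteinPolynomial ℝ p i).eval x * (bernsteinPolynomial ℝ p j).eval x)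
    (hC : ∀ i j, Cmat i j =
      ∫ x in (0 : ℝ)..1,
        (bernsteinPolynomial ℝ p i).eval x *
          (Polynomial.derivative (bernsteinPolynomial ℝ p j)).eval x)
    (hT : ∀ k m : Fin (p + 1), T k m =
      if (k : ℕ) + 1 = (m : ℕ) then (p : ℝ) + 1 - (m : ℕ)
      else if (k : ℕ) = (m : ℕ) then 2 * (m : ℕ) - (p : ℝ)
      else if (k : ℕ) = (m : ℕ) + 1 then -((m : ℕ) + 1)
      else 0) :
    Cmat = M * T := by
  ext i j
  rw [hC, Matrix.mul_apply]
  simp only [hM, hT]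
  simp_rw [← intervalIntegral.integral_mul_const]
  rw [← intervalIntegral.integral_finsetSum
    fun k _ => Continuous.intervalIntegrable (by fun_prop) _ _]
  simp_rw [bernsteinPolynomial.derivative_eval_eq_sum, Finset.mul_sum, mul_assoc]
end
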